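/- Let u : ℝ × [0,∞) → ℝ be smooth, L-periodic in the spatial variable x, strictly positive, and satisfy the aggregation–diffusion equation ∂_t u = ∂_x(u ∂_x(σ log u + W*u + V)) with W even. Then along the solution the free energy satisfies the dissipation identity d/dt F[u(·,t)] = -∫_Ω u(x,t) |∂_x(σ log u(x,t) + (W*u(·,t))(x) + V(x))|² dx for every t > 0; in particular t ↦ F[u(·,t)] is nonincreasing. -/

import Mathlib

open MeasureTheory Real Set

/-- Periodic convolution over Ω = (-L/2, L/2]: `(W*u)(x) = ∫_Ω W(x-y) u(y) dy`. -/
noncomputable def pconv (L : ℝ) (W u : ℝ → ℝ) (x : ℝ) : ℝ :=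
  ∫ y in Set.Ioc (-(L/2)) (L/2), W (x - y) * u y

/-- The free energy functional
`F[u] = ∫_Ω u (σ log u - 1 + ½ (W*u) + V) dx`. -/
noncomputable def Fenergy (L σ : ℝ) (W V u : ℝ → ℝ) : ℝ :=
  ∫ x in Set.Ioc (-(L/2)) (L/2),
    u x * (σ * Real.log (u x) - 1 + (1/2) * pconv L W u x + V x)

open Topology intervalIntegral

/-- Differentiation under the integral sign over a compact interval, for a jointly continuous
derivative. -/
theorem hasDerivAt_intervalIntegral_of_continuousOn {G G' : ℝ → ℝ → ℝ} {S : Set ℝ} {t a b : ℝ}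
    (hS : S ∈ 𝓝 t) (hG : ∀ s ∈ S, Continuous (G s))
    (hG' : ContinuousOn (Function.uncurry G') (S ×ˢ univ))
    (hd : ∀ s ∈ S, ∀ x, HasDerivAt (fun r => G r x) (G' s x) s) :
    HasDerivAt (fun s => ∫ x in a..b, G s x) (∫ x in a..b, G' t x) t := by
  obtain ⟨ε, hε, hball⟩ := Metric.nhds_basis_closedBall.mem_iff.1 hS
  have htS : t ∈ S := mem_of_mem_nhds hS
  obtain ⟨C, hC⟩ := ((isCompact_closedBall t ε).prod (isCompact_uIcc (a := a) (b := b))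
    ).exists_bound_of_continuousOn (hG'.mono (prod_mono hball (subset_univ _)))
  have hcont : Continuous (G' t) :=
    continuousOn_univ.1 <| hG'.comp (f := fun x => (t, x)) (by fun_prop) fun x _ => ⟨htS, mem_univ x⟩
  refine (intervalIntegral.hasDerivAt_integral_of_dominated_loc_of_deriv_le (F := G) (F' := G')
    (bound := fun _ => C) (Metric.closedBall_mem_nhds t hε) ?_ ((hG t htS).intervalIntegrable _ _)
    hcont.aestronglyMeasurable ?_ intervalIntegrable_const ?_).2
  · filter_upwards [hS] with s hs using (hG s hs).aestronglyMeasurable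
  · exact .of_forall fun x hx s hs => hC (s, x) ⟨hs, uIoc_subset_uIcc hx⟩
  · exact .of_forall fun x _ s hs => hd s (hball hs) x

theorem pconv_eq_intervalIntegral {L : ℝ} (hL : 0 < L) (W u : ℝ → ℝ) (x : ℝ) :
    pconv L W u x = ∫ y in (-(L / 2))..(L / 2), W (x - y) * u y := by
  rw [pconv, intervalIntegral.integral_of_le (by linarith)]

theorem Fenergy_eq_intervalIntegral {L : ℝ} (hL : 0 < L) (σ : ℝ) (W V u : ℝ → ℝ) :
    Fenergy L σ W V u = ∫ x in (-(L / 2))..(L / 2),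
      u x * (σ * Real.log (u x) - 1 + (1/2) * pconv L W u x + V x) := by
  rw [Fenergy, intervalIntegral.integral_of_le (by linarith)]

theorem pconv_periodic {L : ℝ} {W : ℝ → ℝ} (hW : Function.Periodic W L) (u : ℝ → ℝ) :
    Function.Periodic (pconv L W u) L := by
  intro x
  simp only [pconv, add_sub_right_comm, hW _]

/-- The periodic convolution of a jointly continuous family is jointly continuous. -/
theorem continuous_pconv_uncurry {L : ℝ} (hL : 0 < L) {W : ℝ → ℝ} (hW : Continuous W)
    {v : ℝ → ℝ → ℝ} (hv : Continuous (Function.uncurry v)) :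
    Continuous fun p : ℝ × ℝ => pconv L W (fun y => v y p.2) p.1 := by
  simp only [pconv_eq_intervalIntegral hL]
  refine continuous_parametric_intervalIntegral_of_continuous'
    (f := fun (p : ℝ × ℝ) y => W (p.1 - y) * v y p.2) ?_ _ _
  have : Continuous fun q : (ℝ × ℝ) × ℝ => v q.2 q.1.2 :=
    hv.comp (by fun_prop : Continuous fun q : (ℝ × ℝ) × ℝ => (q.2, q.1.2))
  exact (hW.comp (by fun_prop : Continuous fun q : (ℝ × ℝ) × ℝ => q.1.1 - q.2)).mul this

theorem continuous_pconv {L : ℝ} (hL : 0 < L) {W u : ℝ → ℝ} (hW : Continuous W)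
    (hu : Continuous u) : Continuous (pconv L W u) :=
  (continuous_pconv_uncurry hL hW (v := fun y _ => u y)
    (hu.comp continuous_fst)).comp (by fun_prop : Continuous fun x : ℝ => (x, (0 : ℝ)))

theorem hasDerivAt_pconv {L : ℝ} (hL : 0 < L) {W u : ℝ → ℝ} (hW : ContDiff ℝ 1 W)
    (hu : Continuous u) (x : ℝ) : HasDerivAt (pconv L W u) (pconv L (deriv W) u x) x := by
  have hW' : Continuous (deriv W) := hW.continuous_deriv le_rfl
  rw [funext (pconv_eq_intervalIntegral hL W u), pconv_eq_intervalIntegral hL]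
  refine hasDerivAt_intervalIntegral_of_continuousOn (G := fun x y => W (x - y) * u y)
    (G' := fun x y => deriv W (x - y) * u y) Filter.univ_mem
    (fun s _ => by have := hW.continuous; fun_prop) (Continuous.continuousOn ?_) fun s _ y => ?_
  · exact (hW'.comp (by fun_prop : Continuous fun q : ℝ × ℝ => q.1 - q.2)).mul
      (hu.comp continuous_snd)
  · have h := (hW.differentiable one_ne_zero (s - y)).hasDerivAt.comp_sub_const s y
    exact h.mul_const (u y)

theorem contDiff_pconv {L : ℝ} (hL : 0 < L) {W u : ℝ → ℝ} {n : ℕ} (hW : ContDiff ℝ n W)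
    (hu : Continuous u) : ContDiff ℝ n (pconv L W u) := by
  induction n generalizing W with
  | zero => exact contDiff_zero.2 (continuous_pconv hL hW.continuous hu)
  | succ n ih =>
    have hW1 : ContDiff ℝ 1 W := hW.of_le (by exact_mod_cast Nat.le_add_left 1 n)
    push_cast at hW ⊢
    refine contDiff_succ_iff_deriv.2
      ⟨fun x => (hasDerivAt_pconv hL hW1 hu x).differentiableAt, fun h => by simp at h, ?_⟩
    rw [funext fun x => (hasDerivAt_pconv hL hW1 hu x).deriv]
    exact ih (contDiff_succ_iff_deriv.1 hW).2.2

/-- Convolution with an even kernel is symmetric. -/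
theorem integral_mul_pconv_comm {L : ℝ} (hL : 0 < L) {W u v : ℝ → ℝ} (hW : Continuous W)
    (hWeven : ∀ x, W (-x) = W x) (hu : Continuous u) (hv : Continuous v) :
    ∫ x in (-(L / 2))..(L / 2), u x * pconv L W v x =
      ∫ x in (-(L / 2))..(L / 2), v x * pconv L W u x := by
  simp only [pconv_eq_intervalIntegral hL, ← intervalIntegral.integral_const_mul]
  have hc : Continuous (Function.uncurry fun x y => u x * (W (x - y) * v y)) := by
    simp only [Function.uncurry_def]; fun_prop
  rw [intervalIntegral_intervalIntegral_swap]
  · refine integral_congr fun x _ => integral_congr fun y _ => ?_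
    rw [← hWeven (x - y), neg_sub]
    ring
  · exact (hc.continuousOn.integrableOn_compact (isCompact_uIcc.prod isCompact_uIcc)).mono_set
      (prod_mono uIoc_subset_uIcc uIoc_subset_uIcc)

/-- Time derivative of the free energy along a smooth family of positive densities. -/
theorem hasDerivAt_Fenergy {L σ : ℝ} (hL : 0 < L) {W V : ℝ → ℝ} (hW : Continuous W)
    (hWeven : ∀ x, W (-x) = W x) (hV : Continuous V) {u ut : ℝ → ℝ → ℝ}
    (hu : Continuous (Function.uncurry u)) (hut : Continuous (Function.uncurry ut))
    (hd : ∀ x s, HasDerivAt (fun r => u x r) (ut x s) s)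
    (hupos : ∀ x t, 0 < t → 0 < u x t) {t : ℝ} (ht : 0 < t) :
    HasDerivAt (fun s => Fenergy L σ W V (fun x => u x s))
      ((∫ x in (-(L / 2))..(L / 2), ut x t *
        (σ * Real.log (u x t) + pconv L W (fun w => u w t) x + V x)) +
        (σ - 1) * ∫ x in (-(L / 2))..(L / 2), ut x t) t := by
  have hus : Continuous fun p : ℝ × ℝ => u p.2 p.1 := hu.comp continuous_swap
  have huts : Continuous fun p : ℝ × ℝ => ut p.2 p.1 := hut.comp continuous_swap
  have hux (s : ℝ) : Continuous fun x => u x s := hu.comp (by fun_prop : Continuous fun x => (x, s))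
  have hutx (s : ℝ) : Continuous fun x => ut x s :=
    hut.comp (by fun_prop : Continuous fun x => (x, s))
  have hP : Continuous fun p : ℝ × ℝ => pconv L W (fun y => u y p.1) p.2 :=
    (continuous_pconv_uncurry hL hW hu).comp continuous_swap
  have hQ : Continuous fun p : ℝ × ℝ => pconv L W (fun y => ut y p.1) p.2 :=
    (continuous_pconv_uncurry hL hW hut).comp continuous_swap
  have hPx (s : ℝ) := continuous_pconv hL hW (hux s)
  have hQx (s : ℝ) := continuous_pconv hL hW (hutx s)
  have hlogx {s : ℝ} (hs : 0 < s) : Continuous fun x => Real.log (u x s) :=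
    (hux s).log fun x => (hupos x s hs).ne'
  have hPd (s x : ℝ) : HasDerivAt (fun r => pconv L W (fun y => u y r) x)
      (pconv L W (fun y => ut y s) x) s := by
    simp only [pconv_eq_intervalIntegral hL]
    refine hasDerivAt_intervalIntegral_of_continuousOn (G := fun s y => W (x - y) * u y s)
      (G' := fun s y => W (x - y) * ut y s) Filter.univ_mem
      (fun s _ => by have := hux s; fun_prop) (Continuous.continuousOn ?_)
      fun s _ y => (hd y s).const_mul _
    simp only [Function.uncurry_def]; fun_prop
  have key : HasDerivAt (fun s => Fenergy L σ W V (fun x => u x s))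
      (∫ x in (-(L / 2))..(L / 2), (ut x t *
        (σ * Real.log (u x t) - 1 + (1/2) * pconv L W (fun w => u w t) x + V x) +
        (σ * ut x t + (1/2) * (u x t * pconv L W (fun w => ut w t) x)))) t := by
    simp only [Fenergy_eq_intervalIntegral hL]
    refine hasDerivAt_intervalIntegral_of_continuousOn
      (G := fun s x => u x s *
        (σ * Real.log (u x s) - 1 + (1/2) * pconv L W (fun w => u w s) x + V x))
      (G' := fun s x => ut x s *
        (σ * Real.log (u x s) - 1 + (1/2) * pconv L W (fun w => u w s) x + V x) +
        (σ * ut x s + (1/2) * (u x s * pconv L W (fun w => ut w s) x)))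
      (Ioi_mem_nhds ht) (fun s hs => ?_) ?_ fun s hs x => ?_
    · have := hux s; have := hPx s; have := hlogx hs
      fun_prop
    · have hlog : ContinuousOn (fun p : ℝ × ℝ => Real.log (u p.2 p.1)) (Ioi 0 ×ˢ univ) :=
        hus.continuousOn.log fun p hp => (hupos p.2 p.1 hp.1).ne'
      exact (huts.continuousOn.mul ((((hlog.const_mul σ).sub continuousOn_const).add
        (hP.const_mul (1/2)).continuousOn).add (hV.comp continuous_snd).continuousOn)).add
        ((huts.const_mul σ).add ((hus.mul hQ).const_mul (1/2))).continuousOn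
    · have hne : u x s ≠ 0 := (hupos x s hs).ne'
      refine ((hd x s).mul ((((((hd x s).log hne).const_mul σ).sub_const 1).add
        ((hPd s x).const_mul (1/2))).add_const (V x))).congr_deriv ?_
      simp only [Pi.add_apply]
      field_simp
  convert key using 1
  have := hux t; have := hutx t; have := hPx t; have := hQx t; have := hlogx ht
  have hsymm := integral_mul_pconv_comm hL hW hWeven (hux t) (hutx t)
  rw [intervalIntegral.integral_add (Continuous.intervalIntegrable (by fun_prop) _ _)
      (Continuous.intervalIntegrable (by fun_prop) _ _),
    intervalIntegral.integral_add (Continuous.intervalIntegrable (by fun_prop) _ _)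
      (Continuous.intervalIntegrable (by fun_prop) _ _),
    intervalIntegral.integral_const_mul, intervalIntegral.integral_const_mul, hsymm,
    ← intervalIntegral.integral_const_mul, ← intervalIntegral.integral_const_mul,
    ← intervalIntegral.integral_const_mul,
    ← intervalIntegral.integral_add (Continuous.intervalIntegrable (by fun_prop) _ _)
      (Continuous.intervalIntegrable (by fun_prop) _ _),
    ← intervalIntegral.integral_add (Continuous.intervalIntegrable (by fun_prop) _ _)
      (Continuous.intervalIntegrable (by fun_prop) _ _),
    ← intervalIntegral.integral_add (Continuous.intervalIntegrable (by fun_prop) _ _)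
      (Continuous.intervalIntegrable (by fun_prop) _ _)]
  refine integral_congr fun x _ => ?_
  ring

/-- The free energy depends continuously on time along any jointly continuous family. -/
theorem continuous_Fenergy {L σ : ℝ} (hL : 0 < L) {W V : ℝ → ℝ} (hW : Continuous W)
    (hV : Continuous V) {u : ℝ → ℝ → ℝ} (hu : Continuous (Function.uncurry u)) :
    Continuous fun s => Fenergy L σ W V (fun x => u x s) := by
  have hus : Continuous fun p : ℝ × ℝ => u p.2 p.1 := hu.comp continuous_swap
  have hP : Continuous fun p : ℝ × ℝ => pconv L W (fun y => u y p.1) p.2 :=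
    (continuous_pconv_uncurry hL hW hu).comp continuous_swap
  have hlog : Continuous fun p : ℝ × ℝ => u p.2 p.1 * Real.log (u p.2 p.1) :=
    Real.continuous_mul_log.comp hus
  simp only [Fenergy_eq_intervalIntegral hL]
  refine continuous_parametric_intervalIntegral_of_continuous' (f := fun s x => u x s *
    (σ * Real.log (u x s) - 1 + (1/2) * pconv L W (fun w => u w s) x + V x)) ?_ _ _
  have : Continuous fun p : ℝ × ℝ => σ * (u p.2 p.1 * Real.log (u p.2 p.1)) +
      u p.2 p.1 * (-1 + (1/2) * pconv L W (fun w => u w p.1) p.2 + V p.2) := by fun_prop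
  refine this.congr fun p => ?_
  simp only [Function.uncurry_def]
  ring

theorem Function.Periodic.deriv_periodic {f : ℝ → ℝ} {c : ℝ} (hf : Function.Periodic f c) :
    Function.Periodic (deriv f) c := fun x => by
  rw [← deriv_comp_add_const, show (fun x => f (x + c)) = f from funext hf]

/-- Periodic integration by parts for a gradient flux `ρ φ'`. -/
theorem integral_deriv_flux {L : ℝ} {ρ φ : ℝ → ℝ} (hρ : ContDiff ℝ 1 ρ) (hφ : ContDiff ℝ 2 φ)
    (hρper : Function.Periodic ρ L) (hφper : Function.Periodic φ L) :
    ∫ x in (-(L / 2))..(L / 2), deriv (fun y => ρ y * deriv φ y) x = 0 ∧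
    ∫ x in (-(L / 2))..(L / 2), deriv (fun y => ρ y * deriv φ y) x * φ x =
      -∫ x in (-(L / 2))..(L / 2), ρ x * deriv φ x ^ 2 := by
  have hφ' : ContDiff ℝ 1 (deriv φ) :=
    (contDiff_succ_iff_deriv.1 (show ContDiff ℝ (1 + 1) φ by norm_num; exact hφ)).2.2
  have hJ : ContDiff ℝ 1 fun y => ρ y * deriv φ y := hρ.mul hφ'
  have hJd (x : ℝ) := (hJ.differentiable one_ne_zero x).hasDerivAt
  have hφd (x : ℝ) := (hφ.differentiable two_ne_zero x).hasDerivAt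
  have hend {f : ℝ → ℝ} (hf : Function.Periodic f L) : f (L / 2) = f (-(L / 2)) := by
    rw [← hf (-(L / 2))]; congr 1; ring
  have hJi := (hJ.continuous_deriv le_rfl).intervalIntegrable (μ := volume) (-(L / 2)) (L / 2)
  have hJend : ρ (L / 2) * deriv φ (L / 2) = ρ (-(L / 2)) * deriv φ (-(L / 2)) := by
    rw [hend hρper, hend hφper.deriv_periodic]
  constructor
  · rw [integral_eq_sub_of_hasDerivAt (fun x _ => hJd x) hJi, hJend, sub_self]
  · have h := integral_mul_deriv_eq_deriv_mul (fun x _ => hJd x) (fun x _ => hφd x) hJi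
      (hφ'.continuous.intervalIntegrable _ _)
    rw [hJend, hend hφper, sub_self, zero_sub] at h
    rw [eq_neg_iff_add_eq_zero, ← eq_neg_iff_add_eq_zero.1 h, add_comm]
    congr 1
    refine integral_congr fun x _ => ?_
    ring

/-- For a smooth, spatially L-periodic, strictly positive solution of
`∂ₜ u = ∂ₓ(u ∂ₓ(σ log u + W*u + V))` with `W` even, the free energy satisfies the
dissipation identity
`d/dt F[u(·,t)] = -∫_Ω u |∂ₓ(σ log u + W*u + V)|² dx` for every `t > 0`;
in particular `t ↦ F[u(·,t)]` is nonincreasing. -/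
theorem energy_dissipation (L σ : ℝ) (hL : 0 < L) (hσ : 0 < σ)
    (W V : ℝ → ℝ) (hW : ContDiff ℝ 2 W) (hWper : Function.Periodic W L)
    (hWeven : ∀ x : ℝ, W (-x) = W x)
    (hV : ContDiff ℝ 2 V) (hVper : Function.Periodic V L)
    (u : ℝ → ℝ → ℝ) (hu : ContDiff ℝ (⊤ : ℕ∞) (Function.uncurry u))
    (huper : ∀ t : ℝ, Function.Periodic (fun x => u x t) L)
    (hupos : ∀ x t : ℝ, 0 ≤ t → 0 < u x t)
    (hpde : ∀ x t : ℝ, 0 ≤ t →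
      deriv (fun s => u x s) t =
        deriv (fun y => u y t *
          deriv (fun z => σ * Real.log (u z t) + pconv L W (fun w => u w t) z + V z) y) x) :
    (∀ t : ℝ, 0 < t →
      HasDerivAt (fun s => Fenergy L σ W V (fun x => u x s))
        (-(∫ x in Set.Ioc (-(L/2)) (L/2),
            u x t *
              (deriv (fun z => σ * Real.log (u z t) + pconv L W (fun w => u w t) z + V z) x) ^ 2)) t) ∧
    AntitoneOn (fun s => Fenergy L σ W V (fun x => u x s)) (Set.Ici 0) := by
  have hdiff (p : ℝ × ℝ) := (hu.differentiable (by simp) p).hasFDerivAt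
  have hd (x s : ℝ) : HasDerivAt (fun r => u x r)
      (fderiv ℝ (Function.uncurry u) (x, s) (0, 1)) s :=
    (hdiff (x, s)).comp_hasDerivAt (f := fun r => (x, r)) s
      ((hasDerivAt_const s x).prodMk (hasDerivAt_id s))
  have hut : Continuous fun p : ℝ × ℝ => fderiv ℝ (Function.uncurry u) p (0, 1) :=
    (hu.continuous_fderiv (by simp)).clm_apply continuous_const
  have hmain (t : ℝ) (ht : 0 < t) : HasDerivAt (fun s => Fenergy L σ W V (fun x => u x s))
      (-(∫ x in Set.Ioc (-(L/2)) (L/2), u x t * (deriv (fun z =>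
        σ * Real.log (u z t) + pconv L W (fun w => u w t) z + V z) x) ^ 2)) t := by
    have hux : ContDiff ℝ 2 fun x => u x t :=
      (contDiff_infty.1 hu 2).comp (contDiff_id.prodMk contDiff_const)
    have hφ : ContDiff ℝ 2 fun z =>
        σ * Real.log (u z t) + pconv L W (fun w => u w t) z + V z :=
      ((contDiff_const.mul (hux.log fun x => (hupos x t ht.le).ne')).add
        (contDiff_pconv (n := 2) hL hW hux.continuous)).add hV
    have hφper : Function.Periodic (fun z =>
        σ * Real.log (u z t) + pconv L W (fun w => u w t) z + V z) L := fun z => by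
      have h : u (z + L) t = u z t := huper t z
      simp only [h, pconv_periodic hWper _ z, hVper z]
    obtain ⟨hmass, hparts⟩ :=
      integral_deriv_flux (hux.of_le one_le_two) hφ (huper t) hφper
    have hF := hasDerivAt_Fenergy (σ := σ) hL hW.continuous hWeven hV.continuous hu.continuous
      (ut := fun x s => fderiv ℝ (Function.uncurry u) (x, s) (0, 1)) hut hd
      (fun x s hs => hupos x s hs.le) ht
    simp only [← (hd _ t).deriv, hpde _ t ht.le] at hF
    rw [hmass, hparts, mul_zero, add_zero,
      intervalIntegral.integral_of_le (by linarith)] at hF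
    exact hF
  refine ⟨hmain, antitoneOn_of_deriv_nonpos (convex_Ici 0)
    (continuous_Fenergy hL hW.continuous hV.continuous hu.continuous).continuousOn ?_ ?_⟩
  all_goals
    rw [interior_Ici]
    intro t ht
  · exact (hmain t ht).differentiableAt.differentiableWithinAt
  · rw [(hmain t ht).deriv, neg_nonpos]
    exact integral_nonneg fun x => mul_nonneg (hupos x t (le_of_lt ht)).le (sq_nonneg _)
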